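/- arXiv:0808.1518 — 5 statements merged into one kernel-verified Lean document; each statement's English description precedes it below -/
import Mathlib

section
/- Let B be a complete commutative unital normed ℝ-algebra with ‖1‖ = 1, and let x ∈ B satisfy ‖1 - x‖ ≤ 1. Define sequences y : ℕ → B by y 0 = 0, y (n+1) = (1/2) • (1 - x + (y n)^2), and r : ℕ → ℝ by r 0 = 0, r (n+1) = (1 + (r n)^2)/2. Then for all n, ‖y n‖ ≤ r n, and ‖y (n+1) - y n‖ ≤ r (n+1) - r n. -/
theorem stmt_4 {B : Type*} [NormedCommRing B] [NormedAlgebra ℝ B]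
    [CompleteSpace B] [NormOneClass B]
    (x : B) (hx : ‖1 - x‖ ≤ 1)
    (y : ℕ → B) (hy0 : y 0 = 0)
    (hy : ∀ n, y (n + 1) = ((1 : ℝ) / 2) • (1 - x + (y n) ^ 2))
    (r : ℕ → ℝ) (hr0 : r 0 = 0)
    (hr : ∀ n, r (n + 1) = (1 + (r n) ^ 2) / 2) :
    (∀ n, ‖y n‖ ≤ r n) ∧ (∀ n, ‖y (n + 1) - y n‖ ≤ r (n + 1) - r n) := by
  have half (z : B) : ‖((1 : ℝ) / 2) • z‖ = ‖z‖ / 2 := by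
    rw [norm_smul, Real.norm_of_nonneg (by norm_num)]
    ring
  have bound : ∀ n, ‖y n‖ ≤ r n := by
    intro n
    induction n with
    | zero => simp [hy0, hr0]
    | succ n ih =>
      rw [hy, hr, half]
      have hsq : ‖y n ^ 2‖ ≤ r n ^ 2 :=
        (norm_pow_le (y n) 2).trans (pow_le_pow_left₀ (norm_nonneg _) ih 2)
      linarith [norm_add_le (1 - x) (y n ^ 2)]
  refine ⟨bound, fun n => ?_⟩
  induction n with
  | zero => simpa [hy0, hr0] using bound 1
  | succ n ih =>
    have hdiff : y (n + 1 + 1) - y (n + 1) =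
        ((1 : ℝ) / 2) • ((y (n + 1) - y n) * (y (n + 1) + y n)) := by
      rw [hy (n + 1)]
      nth_rewrite 2 [hy n]
      rw [← smul_sub]
      congr 1
      ring
    have hsum : ‖y (n + 1) + y n‖ ≤ r (n + 1) + r n :=
      (norm_add_le _ _).trans (add_le_add (bound _) (bound _))
    calc ‖y (n + 1 + 1) - y (n + 1)‖
        = ‖(y (n + 1) - y n) * (y (n + 1) + y n)‖ / 2 := by rw [hdiff, half]
      _ ≤ (r (n + 1) - r n) * (r (n + 1) + r n) / 2 := by
        gcongr
        exact (norm_mul_le _ _).trans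
          (mul_le_mul ih hsum (norm_nonneg _) ((norm_nonneg _).trans ih))
      _ = r (n + 1 + 1) - r (n + 1) := by linarith [hr (n + 1), hr n]
end

section
/- Let B be a complete commutative unital normed ℝ-algebra with ‖1‖ = 1, and let x ∈ B satisfy ‖1 - x‖ ≤ 1. Define y : ℕ → B by y 0 = 0, y (n+1) = (1/2) • (1 - x + (y n)^2). Then y is a Cauchy sequence, and its limit z satisfies (1 - z)^2 = x. -/
/-- The scalar sequence `r 0 = 0`, `r (n + 1) = (1 + r n ^ 2) / 2`, which majorizes the
square root iteration in a Banach algebra. -/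
noncomputable def sqrtMajorant : ℕ → ℝ
  | 0 => 0
  | n + 1 => (1 + sqrtMajorant n ^ 2) / 2

lemma sqrtMajorant_nonneg (n : ℕ) : 0 ≤ sqrtMajorant n := by
  cases n with
  | zero => exact le_rfl
  | succ n => rw [sqrtMajorant]; positivity

lemma sqrtMajorant_le_one (n : ℕ) : sqrtMajorant n ≤ 1 := by
  induction n with
  | zero => exact zero_le_one
  | succ n ih =>
    rw [sqrtMajorant]
    nlinarith [sqrtMajorant_nonneg n]

lemma sqrtMajorant_le_succ (n : ℕ) : sqrtMajorant n ≤ sqrtMajorant (n + 1) := by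
  rw [sqrtMajorant]
  nlinarith [sq_nonneg (1 - sqrtMajorant n)]

lemma summable_sqrtMajorant_succ_sub :
    Summable fun n => sqrtMajorant (n + 1) - sqrtMajorant n := by
  refine summable_of_sum_range_le (c := 1) (fun n => sub_nonneg.2 (sqrtMajorant_le_succ n))
    fun n => ?_
  rw [Finset.sum_range_sub]
  simpa [sqrtMajorant] using sqrtMajorant_le_one n

section SqrtIteration

variable {B : Type*} [NormedCommRing B] [NormedAlgebra ℝ B] {a : B} {y : ℕ → B}

lemma norm_sqrtIteration_le (ha : ‖a‖ ≤ 1) (hy0 : y 0 = 0)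
    (hy : ∀ n, y (n + 1) = ((1 : ℝ) / 2) • (a + y n ^ 2)) (n : ℕ) :
    ‖y n‖ ≤ sqrtMajorant n := by
  induction n with
  | zero => simp [hy0, sqrtMajorant]
  | succ n ih =>
    have hsq : ‖y n ^ 2‖ ≤ sqrtMajorant n ^ 2 :=
      (norm_pow_le' _ two_pos).trans (pow_le_pow_left₀ (norm_nonneg _) ih 2)
    have hadd := norm_add_le a (y n ^ 2)
    rw [hy, norm_smul, sqrtMajorant, Real.norm_of_nonneg (by norm_num)]
    linarith

lemma norm_sqrtIteration_succ_sub_le (ha : ‖a‖ ≤ 1) (hy0 : y 0 = 0)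
    (hy : ∀ n, y (n + 1) = ((1 : ℝ) / 2) • (a + y n ^ 2)) (n : ℕ) :
    ‖y (n + 1) - y n‖ ≤ sqrtMajorant (n + 1) - sqrtMajorant n := by
  have hnorm := norm_sqrtIteration_le ha hy0 hy
  induction n with
  | zero => simpa [hy0, sqrtMajorant] using hnorm 1
  | succ n ih =>
    have hfac : y (n + 1 + 1) - y (n + 1) =
        ((1 : ℝ) / 2) • ((y (n + 1) - y n) * (y (n + 1) + y n)) := by
      rw [hy (n + 1), hy n, ← smul_sub, ← hy n]
      congr 1
      ring
    have hadd : ‖y (n + 1) + y n‖ ≤ sqrtMajorant (n + 1) + sqrtMajorant n :=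
      norm_add_le_of_le (hnorm _) (hnorm _)
    have hmul : ‖(y (n + 1) - y n) * (y (n + 1) + y n)‖ ≤
        (sqrtMajorant (n + 1) - sqrtMajorant n) * (sqrtMajorant (n + 1) + sqrtMajorant n) :=
      norm_mul_le_of_le ih hadd
    rw [hfac, norm_smul, Real.norm_of_nonneg (by norm_num), sqrtMajorant.eq_2 (n + 1)]
    have hsucc := sqrtMajorant.eq_2 n
    linarith

lemma cauchySeq_sqrtIteration (ha : ‖a‖ ≤ 1) (hy0 : y 0 = 0)
    (hy : ∀ n, y (n + 1) = ((1 : ℝ) / 2) • (a + y n ^ 2)) : CauchySeq y := by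
  refine cauchySeq_of_dist_le_of_summable _ (fun n => ?_) summable_sqrtMajorant_succ_sub
  rw [dist_comm, dist_eq_norm]
  exact norm_sqrtIteration_succ_sub_le ha hy0 hy n

end SqrtIteration

theorem stmt_6 {B : Type*} [NormedCommRing B] [NormedAlgebra ℝ B]
    [CompleteSpace B] [NormOneClass B]
    (x : B) (hx : ‖1 - x‖ ≤ 1)
    (y : ℕ → B) (hy0 : y 0 = 0)
    (hy : ∀ n, y (n + 1) = ((1 : ℝ) / 2) • (1 - x + (y n) ^ 2)) :
    CauchySeq y ∧
      ∃ z : B, Filter.Tendsto y Filter.atTop (nhds z) ∧ (1 - z) ^ 2 = x := by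
  have hc := cauchySeq_sqrtIteration hx hy0 hy
  obtain ⟨z, hz⟩ := cauchySeq_tendsto_of_complete hc
  refine ⟨hc, z, hz, ?_⟩
  have hlim : Filter.Tendsto (fun n => y (n + 1)) Filter.atTop
      (nhds (((1 : ℝ) / 2) • (1 - x + z ^ 2))) := by
    simp only [hy]
    exact ((hz.pow 2).const_add _).const_smul _
  have hfix : z = ((1 : ℝ) / 2) • (1 - x + z ^ 2) :=
    tendsto_nhds_unique (hz.comp (Filter.tendsto_add_atTop_nat 1)) hlim
  have htwo : z + z = 1 - x + z ^ 2 := by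
    conv_lhs => rw [hfix]
    rw [← add_smul]
    norm_num
  linear_combination -htwo
end

section
/- Let B be a complete commutative unital normed ℝ-algebra with ‖1‖ = 1 such that ‖a^2‖ = ‖a‖^2 for all a ∈ B and ‖a^2‖ ≤ ‖a^2 + b^2‖ for all a, b ∈ B. If x and y are squares in B (i.e. x = u^2 and y = v^2 for some u, v ∈ B), then x + y is a square in B. -/
/-- An element `1 - c` of a real Banach algebra with `‖c‖ ≤ 1` has a square root: the iteration
`z ↦ (c + z ^ 2) / 2` started at `0` converges, being dominated by the case `c = 1` in `ℝ`. -/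
theorem isSquare_one_sub_of_norm_le_one {B : Type*} [NormedCommRing B] [NormedAlgebra ℝ B]
    [CompleteSpace B] {c : B} (hc : ‖c‖ ≤ 1) : ∃ s : B, 1 - c = s ^ 2 := by
  let z : ℕ → B := fun n => (fun t : B => (2⁻¹ : ℝ) • (c + t ^ 2))^[n] 0
  let w : ℕ → ℝ := fun n => (fun t : ℝ => 2⁻¹ * (1 + t ^ 2))^[n] 0
  have hz (n : ℕ) : z (n + 1) = (2⁻¹ : ℝ) • (c + z n ^ 2) :=
    Function.iterate_succ_apply' _ _ _
  have hw (n : ℕ) : w (n + 1) = 2⁻¹ * (1 + w n ^ 2) := Function.iterate_succ_apply' _ _ _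
  have hz0 : z 0 = 0 := rfl
  have hw0 : w 0 = 0 := rfl
  have hw_mem (n : ℕ) : 0 ≤ w n ∧ w n ≤ 1 := by
    induction n with
    | zero => simp [hw0]
    | succ n ih =>
      rw [hw]
      constructor <;> nlinarith [ih.1, ih.2]
  have hzw (n : ℕ) : ‖z n‖ ≤ w n := by
    induction n with
    | zero => simp [hz0, hw0]
    | succ n ih =>
      rw [hz, hw, norm_smul, Real.norm_of_nonneg (by norm_num)]
      gcongr
      calc ‖c + z n ^ 2‖ ≤ ‖c‖ + ‖z n ^ 2‖ := norm_add_le _ _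
        _ ≤ 1 + ‖z n‖ ^ 2 := add_le_add hc (norm_pow_le' _ two_pos)
        _ ≤ 1 + w n ^ 2 := by gcongr
  have hdiff (n : ℕ) : ‖z (n + 1) - z n‖ ≤ w (n + 1) - w n := by
    induction n with
    | zero =>
      simpa [hz, hw, hz0, hw0, norm_smul] using hc
    | succ n ih =>
      have hzd : z (n + 1 + 1) - z (n + 1) =
          (2⁻¹ : ℝ) • ((z (n + 1) - z n) * (z (n + 1) + z n)) := by
        rw [hz (n + 1)]
        nth_rewrite 2 [hz n]
        rw [← smul_sub]
        congr 1
        ring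
      have hwd : w (n + 1 + 1) - w (n + 1) =
          2⁻¹ * ((w (n + 1) - w n) * (w (n + 1) + w n)) := by
        rw [hw (n + 1)]
        nth_rewrite 2 [hw n]
        ring
      rw [hzd, hwd, norm_smul, Real.norm_of_nonneg (by norm_num)]
      gcongr
      refine (norm_mul_le _ _).trans ?_
      exact mul_le_mul ih ((norm_add_le _ _).trans (add_le_add (hzw _) (hzw _)))
        (norm_nonneg _) ((norm_nonneg _).trans ih)
  have hsummable : Summable fun n => w (n + 1) - w n := by
    refine summable_of_sum_range_le (c := 1) (fun n => (norm_nonneg _).trans (hdiff n)) fun n => ?_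
    rw [Finset.sum_range_sub, hw0, sub_zero]
    exact (hw_mem n).2
  have hcauchy : CauchySeq z := by
    refine cauchySeq_of_dist_le_of_summable _ (fun n => ?_) hsummable
    rw [dist_comm, dist_eq_norm]
    exact hdiff n
  obtain ⟨l, hl⟩ := cauchySeq_tendsto_of_complete hcauchy
  have hfix : l = (2⁻¹ : ℝ) • (c + l ^ 2) := by
    refine tendsto_nhds_unique ((Filter.tendsto_add_atTop_iff_nat 1).2 hl) ?_
    simp only [hz]
    exact ((hl.pow 2).const_add c).const_smul _
  refine ⟨1 - l, ?_⟩
  have h2 : (2 : ℝ) • l = c + l ^ 2 := by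
    nth_rewrite 1 [hfix]
    rw [smul_smul]
    norm_num
  rw [two_smul] at h2
  linear_combination h2

theorem norm_one_sub_sq_le_one {B : Type*} [NormedCommRing B] [NormedAlgebra ℝ B]
    [CompleteSpace B] [NormOneClass B]
    (hsum : ∀ a b : B, ‖a ^ 2‖ ≤ ‖a ^ 2 + b ^ 2‖) {u : B} (hu : ‖u ^ 2‖ ≤ 1) :
    ‖1 - u ^ 2‖ ≤ 1 := by
  obtain ⟨s, hs⟩ := isSquare_one_sub_of_norm_le_one hu
  have h := hsum s u
  rwa [← hs, sub_add_cancel, norm_one] at h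

theorem stmt_7 {B : Type*} [NormedCommRing B] [NormedAlgebra ℝ B]
    [CompleteSpace B] [NormOneClass B]
    (hsq : ∀ a : B, ‖a ^ 2‖ = ‖a‖ ^ 2)
    (hsum : ∀ a b : B, ‖a ^ 2‖ ≤ ‖a ^ 2 + b ^ 2‖)
    (x y : B) (hx : ∃ u : B, x = u ^ 2) (hy : ∃ v : B, y = v ^ 2) :
    ∃ w : B, x + y = w ^ 2 := by
  obtain ⟨u, rfl⟩ := hx
  obtain ⟨v, rfl⟩ := hy
  let r : ℝ := 1 + ‖u‖ + ‖v‖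
  have hr : 0 < r := by positivity
  have hscale (a : B) (ha : ‖a‖ ≤ r) : ‖1 - (r⁻¹ • a) ^ 2‖ ≤ 1 := by
    refine norm_one_sub_sq_le_one hsum ?_
    rw [hsq, norm_smul, Real.norm_of_nonneg (by positivity)]
    refine pow_le_one₀ (by positivity) ?_
    rwa [inv_mul_le_one₀ hr]
  have hu := hscale u (by simp only [r]; linarith [norm_nonneg v])
  have hv := hscale v (by simp only [r]; linarith [norm_nonneg u])
  have hmid : ‖(2⁻¹ : ℝ) • ((1 - (r⁻¹ • u) ^ 2) + (1 - (r⁻¹ • v) ^ 2))‖ ≤ 1 := by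
    rw [norm_smul, Real.norm_of_nonneg (by norm_num)]
    linarith [norm_add_le (1 - (r⁻¹ • u) ^ 2) (1 - (r⁻¹ • v) ^ 2)]
  obtain ⟨s, hs⟩ := isSquare_one_sub_of_norm_le_one hmid
  refine ⟨(r * √2) • s, ?_⟩
  rw [smul_pow, ← hs, mul_pow, Real.sq_sqrt zero_le_two, smul_pow, smul_pow]
  match_scalars <;> field_simp <;> norm_num
end

section
/- Let B be a complete commutative unital normed ℝ-algebra with ‖1‖ = 1 such that ‖a^2‖ = ‖a‖^2 for all a ∈ B and ‖a^2‖ ≤ ‖a^2 + b^2‖ for all a, b ∈ B. Then for x ∈ B: ‖x‖ ≤ 1 and ‖1 - x‖ ≤ 1 if and only if both x and 1 - x are squares in B. -/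
/-- The iteration `w ↦ (y + w ^ 2) / 2` started at `0`, whose fixed points `w` satisfy
`(1 - w) ^ 2 = 1 - y`. -/
noncomputable def sqrtIter {B : Type*} [NormedCommRing B] [NormedAlgebra ℝ B] (y : B) : ℕ → B
  | 0 => 0
  | n + 1 => (1 / 2 : ℝ) • (y + sqrtIter y n ^ 2)

lemma sqrtIter_one_nonneg (n : ℕ) : 0 ≤ sqrtIter (1 : ℝ) n := by
  cases n with
  | zero => simp [sqrtIter]
  | succ n => simp only [sqrtIter, smul_eq_mul]; positivity

lemma sqrtIter_one_le_one (n : ℕ) : sqrtIter (1 : ℝ) n ≤ 1 := by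
  induction n with
  | zero => simp [sqrtIter]
  | succ n ih =>
    simp only [sqrtIter, smul_eq_mul]
    nlinarith [sqrtIter_one_nonneg n]

section

variable {B : Type*} [NormedCommRing B] [NormedAlgebra ℝ B]

lemma norm_sqrtIter_le {y : B} (hy : ‖y‖ ≤ 1) (n : ℕ) :
    ‖sqrtIter y n‖ ≤ sqrtIter (1 : ℝ) n := by
  induction n with
  | zero => simp [sqrtIter]
  | succ n ih =>
    simp only [sqrtIter, norm_smul, smul_eq_mul]
    rw [Real.norm_of_nonneg (by norm_num)]
    gcongr
    refine (norm_add_le _ _).trans (add_le_add hy ?_)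
    exact (norm_pow_le' _ two_pos).trans (by gcongr)

lemma norm_sqrtIter_succ_sub_le {y : B} (hy : ‖y‖ ≤ 1) (n : ℕ) :
    ‖sqrtIter y (n + 1) - sqrtIter y n‖ ≤ sqrtIter (1 : ℝ) (n + 1) - sqrtIter (1 : ℝ) n := by
  induction n with
  | zero =>
    simpa [sqrtIter, norm_smul] using hy
  | succ n ih =>
    have key (z w w' : B) : (1 / 2 : ℝ) • (z + w ^ 2) - (1 / 2 : ℝ) • (z + w' ^ 2) =
        (1 / 2 : ℝ) • ((w - w') * (w + w')) := by
      rw [← smul_sub]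
      congr 1
      ring
    have hreal : sqrtIter (1 : ℝ) (n + 1 + 1) - sqrtIter (1 : ℝ) (n + 1) =
        1 / 2 * ((sqrtIter (1 : ℝ) (n + 1) - sqrtIter (1 : ℝ) n) *
          (sqrtIter (1 : ℝ) (n + 1) + sqrtIter (1 : ℝ) n)) := by
      rw [sqrtIter.eq_2 (1 : ℝ) (n + 1)]
      nth_rw 2 [sqrtIter.eq_2]
      simp only [smul_eq_mul]
      ring
    have hB : sqrtIter y (n + 1 + 1) - sqrtIter y (n + 1) =
        (1 / 2 : ℝ) • ((sqrtIter y (n + 1) - sqrtIter y n) *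
          (sqrtIter y (n + 1) + sqrtIter y n)) := key y _ _
    rw [hreal, hB, norm_smul, Real.norm_of_nonneg (by norm_num)]
    gcongr
    refine (norm_mul_le _ _).trans (mul_le_mul ih ?_ (norm_nonneg _) ((norm_nonneg _).trans ih))
    exact (norm_add_le _ _).trans
      (add_le_add (norm_sqrtIter_le hy _) (norm_sqrtIter_le hy _))

lemma cauchySeq_sqrtIter {y : B} (hy : ‖y‖ ≤ 1) : CauchySeq (sqrtIter y) := by
  refine cauchySeq_of_dist_le_of_summable
    (fun n => sqrtIter (1 : ℝ) (n + 1) - sqrtIter (1 : ℝ) n) (fun n => ?_) ?_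
  · rw [dist_comm, dist_eq_norm]
    exact norm_sqrtIter_succ_sub_le hy n
  · refine summable_of_sum_range_le (c := 1)
      (fun n => (norm_nonneg _).trans (norm_sqrtIter_succ_sub_le (y := (1 : ℝ)) (by simp) n))
      (fun n => ?_)
    rw [Finset.sum_range_sub]
    simpa [sqrtIter] using sqrtIter_one_le_one n

lemma exists_one_sub_eq_sq [CompleteSpace B] {y : B} (hy : ‖y‖ ≤ 1) :
    ∃ u : B, 1 - y = u ^ 2 := by
  obtain ⟨w, hw⟩ := cauchySeq_tendsto_of_complete (cauchySeq_sqrtIter hy)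
  have hfix : w = (1 / 2 : ℝ) • (y + w ^ 2) :=
    tendsto_nhds_unique ((Filter.tendsto_add_atTop_iff_nat 1).2 hw)
      (((hw.pow 2).const_add y).const_smul (1 / 2 : ℝ))
  have htwo : w + w = y + w ^ 2 := by
    nth_rw 1 2 [hfix]
    rw [← add_smul]
    norm_num
  exact ⟨1 - w, by linear_combination htwo⟩

end


theorem stmt_8 {B : Type*} [NormedCommRing B] [NormedAlgebra ℝ B]
    [CompleteSpace B] [NormOneClass B]
    (hsq : ∀ a : B, ‖a ^ 2‖ = ‖a‖ ^ 2)
    (hsum : ∀ a b : B, ‖a ^ 2‖ ≤ ‖a ^ 2 + b ^ 2‖)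
    (x : B) :
    (‖x‖ ≤ 1 ∧ ‖1 - x‖ ≤ 1) ↔
      ((∃ u : B, x = u ^ 2) ∧ (∃ v : B, 1 - x = v ^ 2)) := by
  constructor
  · rintro ⟨hx, hx'⟩
    refine ⟨?_, exists_one_sub_eq_sq hx⟩
    simpa using exists_one_sub_eq_sq hx'
  · rintro ⟨⟨u, hu⟩, ⟨v, hv⟩⟩
    have huv : u ^ 2 + v ^ 2 = 1 := by rw [← hu, ← hv]; ring
    constructor
    · simpa [huv, hu] using hsum u v
    · simpa [add_comm, huv, hv] using hsum v u
end

section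
/- Let A be a commutative unital C*-algebra, let a and c be self-adjoint elements of A with 0 ≤ c, and suppose there exists a real number r > 0 such that r • 1 ≤ a * c. Then there exists a real number s > 0 such that s • 1 ≤ a. -/
theorem stmt_10 {A : Type*} [NormedCommRing A] [StarRing A] [CStarRing A]
    [NormedAlgebra ℂ A] [StarModule ℂ A] [CompleteSpace A]
    [PartialOrder A] [StarOrderedRing A]
    (a c : A) (ha : star a = a) (hc : star c = c) (hc0 : 0 ≤ c)
    (h : ∃ r : ℝ, 0 < r ∧ r • (1 : A) ≤ a * c) :
    ∃ s : ℝ, 0 < s ∧ s • (1 : A) ≤ a := by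
  let _ : CommCStarAlgebra A := {}
  obtain _ | _ := subsingleton_or_nontrivial A
  · exact ⟨1, one_pos, (Subsingleton.elim _ _).le⟩
  obtain ⟨r, hr, hrac⟩ := h
  have hac : IsStrictlyPositive (a * c) := by
    rw [← Algebra.algebraMap_eq_smul_one] at hrac
    exact (isStrictlyPositive_algebraMap hr).of_le hrac
  have hcu : IsUnit c := isUnit_of_mul_isUnit_right hac.isUnit
  have hci : IsStrictlyPositive (Ring.inverse c) := (hcu.isStrictlyPositive hc0).ringInverse
  have h_pos : IsStrictlyPositive a := by
    have := (hac.commute_iff hci).mp (Commute.all _ _)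
    rwa [mul_assoc, Ring.mul_inverse_cancel _ hcu, mul_one] at this
  simp_rw [← Algebra.algebraMap_eq_smul_one]
  exact (CFC.exists_pos_algebraMap_le_iff ha).mpr fun x hx ↦ h_pos.spectrum_pos hx
end
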